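/- Suppose Φ is irreducible and of type G₂, i.e. there exist roots a, b ∈ Φ with ⟨a, b∨⟩ · ⟨b, a∨⟩ = 3. Then no combinatorial abelian ideal I ⊆ Φ⁺ contains two distinct orthogonal roots. -/

import Mathlib

open scoped RealInnerProductSpace

variable {V : Type*} [NormedAddCommGroup V] [InnerProductSpace ℝ V] [FiniteDimensional ℝ V]

/-- The Cartan integer `⟨a, b∨⟩ = 2⟪a,b⟫/⟪b,b⟫`, i.e. the pairing of `a` with the coroot
of `b`, in a Euclidean realization of the root system. -/
noncomputable def cartan (a b : V) : ℝ := 2 * ⟪a, b⟫ / ⟪b, b⟫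

/-- A finite reduced crystallographic root system `Φ` in a Euclidean space `V`,
together with a base `Δ` (the set `simples`); the corresponding positive system `Φ⁺`
consists of the roots that are nonnegative integer combinations of simple roots. -/
structure RootSystemWithBase (V : Type*) [NormedAddCommGroup V] [InnerProductSpace ℝ V] :
    Type _ where
  roots : Set V
  finite : roots.Finite
  ne_zero : ∀ a ∈ roots, a ≠ (0 : V)
  neg_mem : ∀ a ∈ roots, -a ∈ roots
  reduced : ∀ a ∈ roots, ∀ t : ℝ, t • a ∈ roots → t = 1 ∨ t = -1
  crystal : ∀ a ∈ roots, ∀ b ∈ roots, ∃ n : ℤ, cartan a b = (n : ℝ)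
  reflect_mem : ∀ a ∈ roots, ∀ b ∈ roots, a - cartan a b • b ∈ roots
  simples : Set V
  simples_sub : simples ⊆ roots
  indep : LinearIndependent ℝ (fun a : simples => (a : V))
  decomp : ∀ a ∈ roots,
    (∃ c : V →₀ ℕ, ↑c.support ⊆ simples ∧ a = c.sum fun b n => (n : ℝ) • b) ∨
    (∃ c : V →₀ ℕ, ↑c.support ⊆ simples ∧ -a = c.sum fun b n => (n : ℝ) • b)

namespace RootSystemWithBase

/-- `v` is a nonnegative integer combination of simple roots. -/
def IsNN (R : RootSystemWithBase V) (v : V) : Prop :=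
  ∃ c : V →₀ ℕ, ↑c.support ⊆ R.simples ∧ v = c.sum fun b n => (n : ℝ) • b

/-- The set `Φ⁺` of positive roots. -/
def pos (R : RootSystemWithBase V) : Set V :=
  {a ∈ R.roots | R.IsNN a}

/-- A combinatorial abelian ideal in `Φ⁺`: a subset `I ⊆ Φ⁺` such that (i) if `a ∈ I`,
`b ∈ Φ⁺` and `b - a` is a nonnegative integer combination of simple roots then `b ∈ I`,
and (ii) `a + b ∉ Φ` for all `a, b ∈ I`. -/
def IsAbelianIdeal (R : RootSystemWithBase V) (I : Set V) : Prop :=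
  I ⊆ R.pos ∧
  (∀ a ∈ I, ∀ b ∈ R.pos, R.IsNN (b - a) → b ∈ I) ∧
  (∀ a ∈ I, ∀ b ∈ I, a + b ∉ R.roots)

end RootSystemWithBase

section G2

variable {E : Type*} [NormedAddCommGroup E] [InnerProductSpace ℝ E]

/-- The coefficients `(x, y)` of the roots `x q + y p` of a root system of type `G₂` with short
simple root `q` and long simple root `p`. -/
def g2Coeffs : List (ℤ × ℤ) :=
  [(1, 0), (0, 1), (1, 1), (2, 1), (3, 1), (3, 2),
    (-1, 0), (0, -1), (-1, -1), (-2, -1), (-3, -1), (-3, -2)]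

/-- The invariant form on the `G₂` root lattice, normalized so that short roots have value `2`. -/
def g2Form (c d : ℤ × ℤ) : ℤ :=
  2 * c.1 * d.1 - 3 * (c.1 * d.2 + c.2 * d.1) + 6 * c.2 * d.2

theorem g2Coeffs_orthogonal : ∀ c ∈ g2Coeffs, ∀ c' ∈ g2Coeffs, g2Form c c' = 0 →
    ∃ d ∈ g2Coeffs, d + d = c + c' ∧ d - c ∈ g2Coeffs ∧
      (d + c ∈ g2Coeffs ∨ d + c' ∈ g2Coeffs) := by
  decide +kernel

/-- The vector `x q + y p`. -/
def g2Comb (p q : E) (c : ℤ × ℤ) : E := c.1 • q + c.2 • p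

omit [InnerProductSpace ℝ E] in
theorem g2Comb_add (p q : E) (c d : ℤ × ℤ) :
    g2Comb p q (c + d) = g2Comb p q c + g2Comb p q d := by
  simp only [g2Comb, Prod.fst_add, Prod.snd_add]; module

omit [InnerProductSpace ℝ E] in
theorem g2Comb_sub (p q : E) (c d : ℤ × ℤ) :
    g2Comb p q (c - d) = g2Comb p q c - g2Comb p q d := by
  simp only [g2Comb, Prod.fst_sub, Prod.snd_sub]; module

theorem inner_g2Comb_right (v p q : E) (c : ℤ × ℤ) :
    ⟪v, g2Comb p q c⟫ = c.1 * ⟪v, q⟫ + c.2 * ⟪v, p⟫ := by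
  simp only [g2Comb, ← Int.cast_smul_eq_zsmul ℝ, inner_add_right, real_inner_smul_right]

theorem two_mul_inner_g2Comb {p q : E} (hpp : ⟪p, p⟫ = 3 * ⟪q, q⟫)
    (hpq : 2 * ⟪p, q⟫ = -3 * ⟪q, q⟫) (c d : ℤ × ℤ) :
    2 * ⟪g2Comb p q c, g2Comb p q d⟫ = g2Form c d * ⟪q, q⟫ := by
  rw [inner_g2Comb_right, real_inner_comm q, real_inner_comm p, inner_g2Comb_right,
    inner_g2Comb_right, real_inner_comm p q, hpp]
  simp only [g2Form]
  push_cast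
  linear_combination (c.1 * d.2 + c.2 * d.1 : ℝ) * hpq

namespace RootSystemWithBase

theorem IsNN.add {R : RootSystemWithBase E} {u v : E} (hu : R.IsNN u) (hv : R.IsNN v) :
    R.IsNN (u + v) := by
  classical
  obtain ⟨c, hc, rfl⟩ := hu
  obtain ⟨d, hd, rfl⟩ := hv
  refine ⟨c + d, fun x hx => ?_, ?_⟩
  · rcases Finset.mem_union.1 (Finsupp.support_add hx) with h | h
    exacts [hc h, hd h]
  · rw [Finsupp.sum_add_index' (by simp) (by intros; push_cast; module)]

variable (R : RootSystemWithBase E)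

theorem inner_self_pos {u : E} (hu : u ∈ R.roots) : 0 < ⟪u, u⟫ :=
  real_inner_self_pos.2 (R.ne_zero u hu)

theorem exists_two_mul_inner_eq {u v : E} (hu : u ∈ R.roots) (hv : v ∈ R.roots) :
    ∃ n : ℤ, 2 * ⟪u, v⟫ = n * ⟪v, v⟫ := by
  obtain ⟨n, hn⟩ := R.crystal u hu v hv
  exact ⟨n, (div_eq_iff (R.inner_self_pos hv).ne').1 hn⟩

theorem sub_zsmul_mem {u v : E} (hu : u ∈ R.roots) (hv : v ∈ R.roots) {n : ℤ}
    (h : 2 * ⟪u, v⟫ = n * ⟪v, v⟫) : u - n • v ∈ R.roots := by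
  have hc : cartan u v = n := (div_eq_iff (R.inner_self_pos hv).ne').2 h
  simpa [hc, Int.cast_smul_eq_zsmul] using R.reflect_mem u hu v hv

theorem inner_mul_inner_lt {u v : E} (hu : u ∈ R.roots) (hv : v ∈ R.roots) (h : u ≠ v)
    (h' : u ≠ -v) : ⟪u, v⟫ * ⟪u, v⟫ < ⟪u, u⟫ * ⟪v, v⟫ := by
  refine lt_of_le_of_ne (real_inner_mul_inner_self_le u v) fun heq => ?_
  have hB := (R.inner_self_pos hv).ne'
  have hz : u - (⟪u, v⟫ / ⟪v, v⟫) • v = 0 := by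
    rw [← inner_self_eq_zero (𝕜 := ℝ)]
    simp only [inner_sub_left, inner_sub_right, real_inner_smul_left, real_inner_smul_right,
      real_inner_comm u v]
    field_simp
    linarith
  have hu' := sub_eq_zero.1 hz
  rcases R.reduced v hv (⟪u, v⟫ / ⟪v, v⟫) (hu' ▸ hu) with ht | ht <;> rw [ht] at hu'
  · exact h (by simpa using hu')
  · exact h' (by simpa using hu')

/-- The possible pairs of Cartan integers of two non-proportional roots. -/
theorem exists_cartan_pair {u v : E} (hu : u ∈ R.roots) (hv : v ∈ R.roots) (h : u ≠ v)
    (h' : u ≠ -v) : ∃ m n : ℤ, 2 * ⟪u, v⟫ = m * ⟪v, v⟫ ∧ 2 * ⟪u, v⟫ = n * ⟪u, u⟫ ∧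
      (m, n) ∈ ([(0, 0), (1, 1), (-1, -1), (1, 2), (2, 1), (-1, -2), (-2, -1), (1, 3), (3, 1),
        (-1, -3), (-3, -1)] : List (ℤ × ℤ)) := by
  obtain ⟨m, hm⟩ := R.exists_two_mul_inner_eq hu hv
  obtain ⟨n, hn⟩ := R.exists_two_mul_inner_eq hv hu
  rw [real_inner_comm] at hn
  refine ⟨m, n, hm, hn, ?_⟩
  have hA := R.inner_self_pos hu
  have hB := R.inner_self_pos hv
  have hlt := R.inner_mul_inner_lt hu hv h h'
  have hmn : m * n * (⟪u, u⟫ * ⟪v, v⟫) = 4 * (⟪u, v⟫ * ⟪u, v⟫) := by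
    linear_combination -(2 * ⟪u, v⟫) * hm - m * ⟪v, v⟫ * hn
  have hlt4 : m * n < 4 := by
    have : (m * n : ℝ) < 4 := by
      by_contra! hc
      nlinarith [mul_le_mul_of_nonneg_right hc (mul_pos hA hB).le]
    exact_mod_cast this
  have hzero : m * n ≤ 0 → m = 0 ∧ n = 0 := by
    intro hle
    have hle' : (m * n : ℝ) ≤ 0 := by exact_mod_cast hle
    have hi : ⟪u, v⟫ = 0 := by
      nlinarith [mul_nonneg (neg_nonneg.2 hle') (mul_pos hA hB).le, mul_self_nonneg ⟪u, v⟫]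
    rw [hi, mul_zero] at hm hn
    exact ⟨by exact_mod_cast (mul_eq_zero.1 hm.symm).resolve_right hB.ne',
      by exact_mod_cast (mul_eq_zero.1 hn.symm).resolve_right hA.ne'⟩
  rcases le_or_gt (m * n) 0 with hle | hgt
  · obtain ⟨rfl, rfl⟩ := hzero hle
    simp
  · have hm3 : -3 ≤ m ∧ m ≤ 3 := by
      rcases pos_and_pos_or_neg_and_neg_of_mul_pos hgt with ⟨h₁, h₂⟩ | ⟨h₁, h₂⟩ <;>
        constructor <;> nlinarith
    have hn3 : -3 ≤ n ∧ n ≤ 3 := by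
      rcases pos_and_pos_or_neg_and_neg_of_mul_pos hgt with ⟨h₁, h₂⟩ | ⟨h₁, h₂⟩ <;>
        constructor <;> nlinarith
    obtain ⟨hm1, hm2⟩ := hm3
    obtain ⟨hn1, hn2⟩ := hn3
    clear hzero hmn hm hn
    interval_cases m <;> interval_cases n <;> simp at hlt4 hgt ⊢

theorem exists_long_short
    (hG2 : ∃ a ∈ R.roots, ∃ b ∈ R.roots, cartan a b * cartan b a = 3) :
    ∃ p ∈ R.roots, ∃ q ∈ R.roots, ⟪p, p⟫ = 3 * ⟪q, q⟫ ∧ 2 * ⟪p, q⟫ = -3 * ⟪q, q⟫ := by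
  obtain ⟨a, ha, b, hb, hab⟩ := hG2
  have hA := R.inner_self_pos ha
  have hB := R.inner_self_pos hb
  have h4 : 4 * (⟪a, b⟫ * ⟪a, b⟫) = 3 * (⟪a, a⟫ * ⟪b, b⟫) := by
    rw [cartan, cartan, real_inner_comm a b] at hab
    field_simp at hab
    linarith
  have hne : a ≠ b := by
    rintro rfl
    nlinarith [mul_pos hA hA]
  have hne' : a ≠ -b := by
    rintro rfl
    simp only [inner_neg_left, inner_neg_right] at h4
    nlinarith [mul_pos hB hB]
  obtain ⟨m, n, hm, hn, hmn⟩ := R.exists_cartan_pair ha hb hne hne'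
  have h3 : m * n = 3 := by
    have : (m * n : ℝ) = 3 := by
      apply mul_right_cancel₀ (mul_pos hA hB).ne'
      linear_combination h4 - 2 * ⟪a, b⟫ * hm - m * ⟪b, b⟫ * hn
    exact_mod_cast this
  simp only [List.mem_cons, Prod.mk.injEq, List.not_mem_nil, or_false] at hmn
  rcases hmn with ⟨rfl, rfl⟩ | ⟨rfl, rfl⟩ | ⟨rfl, rfl⟩ | ⟨rfl, rfl⟩ | ⟨rfl, rfl⟩ | ⟨rfl, rfl⟩ |
    ⟨rfl, rfl⟩ | ⟨rfl, rfl⟩ | ⟨rfl, rfl⟩ | ⟨rfl, rfl⟩ | ⟨rfl, rfl⟩ <;> try norm_num at h3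
  all_goals push_cast at hm hn
  · refine ⟨-b, R.neg_mem b hb, a, ha, ?_, ?_⟩ <;>
      simp only [inner_neg_left, inner_neg_right, real_inner_comm a b] <;> linarith
  · refine ⟨-a, R.neg_mem a ha, b, hb, ?_, ?_⟩ <;>
      simp only [inner_neg_left, inner_neg_right] <;> linarith
  · refine ⟨b, hb, a, ha, ?_, ?_⟩ <;> linarith [real_inner_comm a b]
  · exact ⟨a, ha, b, hb, by linarith, by linarith⟩

section LongShort

variable {p q : E} (hp : p ∈ R.roots) (hq : q ∈ R.roots) (hpp : ⟪p, p⟫ = 3 * ⟪q, q⟫)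
  (hpq : 2 * ⟪p, q⟫ = -3 * ⟪q, q⟫)

include hp hq hpp hpq

theorem g2Comb_mem_roots : ∀ c ∈ g2Coeffs, g2Comb p q c ∈ R.roots := by
  have h01 : g2Comb p q (0, 1) ∈ R.roots := by simpa [g2Comb] using hp
  have h10 : g2Comb p q (1, 0) ∈ R.roots := by simpa [g2Comb] using hq
  have refl {c d : ℤ × ℤ} (hc : g2Comb p q c ∈ R.roots) (hd : g2Comb p q d ∈ R.roots) (n : ℤ)
      (h : 2 * g2Form c d = n * g2Form d d) : g2Comb p q (c - n • d) ∈ R.roots := by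
    have h' : (2 * g2Form c d : ℝ) = n * g2Form d d := by exact_mod_cast h
    have e : g2Comb p q (c - n • d) = g2Comb p q c - n • g2Comb p q d := by
      simp only [g2Comb, Prod.fst_sub, Prod.snd_sub, Prod.smul_fst, Prod.smul_snd, smul_eq_mul]
      module
    rw [e]
    apply R.sub_zsmul_mem hc hd
    linear_combination two_mul_inner_g2Comb hpp hpq c d + (⟪q, q⟫ / 2) * h'
      - (n / 2) * two_mul_inner_g2Comb hpp hpq d d
  have h11 : g2Comb p q (1, 1) ∈ R.roots := by
    simpa using refl h10 h01 (-1) (by decide)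
  have h31 : g2Comb p q (3, 1) ∈ R.roots := by
    simpa using refl h01 h10 (-3) (by decide)
  have h21 : g2Comb p q (2, 1) ∈ R.roots := by
    simpa using refl h11 h10 (-1) (by decide)
  have h32 : g2Comb p q (3, 2) ∈ R.roots := by
    simpa using refl h31 h01 (-1) (by decide)
  have hneg {c : ℤ × ℤ} (hc : g2Comb p q c ∈ R.roots) : g2Comb p q (-c) ∈ R.roots := by
    have := R.neg_mem _ hc
    rwa [show -g2Comb p q c = g2Comb p q (-c) by
      simp only [g2Comb, Prod.fst_neg, Prod.snd_neg]; module] at this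
  simp only [g2Coeffs, List.forall_mem_cons, List.not_mem_nil, IsEmpty.forall_iff, implies_true,
    and_true]
  exact ⟨h10, h01, h11, h21, h31, h32, hneg h10, hneg h01, hneg h11, hneg h21, hneg h31,
    hneg h32⟩

theorem inner_eq_zero_of_ne_g2Comb {v : E} (hv : v ∈ R.roots)
    (hne : ∀ c ∈ g2Coeffs, g2Comb p q c ≠ v) : ⟪v, q⟫ = 0 ∧ ⟪v, p⟫ = 0 := by
  have hA := R.inner_self_pos hv
  have ht := R.inner_self_pos hq
  have pair (c : ℤ × ℤ) (hc : c ∈ g2Coeffs) (hc' : -c ∈ g2Coeffs) : ∃ m n : ℤ,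
      4 * (c.1 * ⟪v, q⟫ + c.2 * ⟪v, p⟫) = m * (g2Form c c * ⟪q, q⟫) ∧
      2 * (c.1 * ⟪v, q⟫ + c.2 * ⟪v, p⟫) = n * ⟪v, v⟫ ∧
      (m, n) ∈ ([(0, 0), (1, 1), (-1, -1), (1, 2), (2, 1), (-1, -2), (-2, -1), (1, 3), (3, 1),
        (-1, -3), (-3, -1)] : List (ℤ × ℤ)) := by
    obtain ⟨m, n, hm, hn, h⟩ := R.exists_cartan_pair hv
      (R.g2Comb_mem_roots hp hq hpp hpq c hc) (hne c hc).symm <| by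
        intro h
        apply hne _ hc'
        rw [h]
        simp only [g2Comb, Prod.fst_neg, Prod.snd_neg]; module
    rw [inner_g2Comb_right] at hm hn
    exact ⟨m, n, by linear_combination 2 * hm + m * two_mul_inner_g2Comb hpp hpq c c, hn, h⟩
  obtain ⟨a, a', ha, ha', hS₁⟩ := pair (1, 0) (by decide) (by decide)
  obtain ⟨b, b', hb, hb', hS₂⟩ := pair (0, 1) (by decide) (by decide)
  obtain ⟨c, c', hc, hc', hS₃⟩ := pair (1, 1) (by decide) (by decide)
  obtain ⟨d, d', hd, hd', hS₄⟩ := pair (2, 1) (by decide) (by decide)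
  obtain ⟨e, e', he, he', hS₅⟩ := pair (3, 1) (by decide) (by decide)
  obtain ⟨f, f', hf, hf', hS₆⟩ := pair (3, 2) (by decide) (by decide)
  rw [real_inner_self_eq_norm_sq] at hA ht
  norm_num [g2Form] at ha ha' hb hb' hc hc' hd hd' he he' hf hf'
  have of_mul {x y : ℤ} {z : ℝ} (hz : 0 < z) (h : (x : ℝ) * z = y * z) : x = y := by
    exact_mod_cast mul_right_cancel₀ hz.ne' h
  have h₁ : c = a + 3 * b := of_mul ht (by push_cast; linarith)
  have h₂ : c' = a' + b' := of_mul hA (by push_cast; linarith)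
  have h₃ : d = 2 * a + 3 * b := of_mul ht (by push_cast; linarith)
  have h₄ : d' = 2 * a' + b' := of_mul hA (by push_cast; linarith)
  have h₅ : e = a + b := of_mul ht (by push_cast; linarith)
  have h₆ : e' = 3 * a' + b' := of_mul hA (by push_cast; linarith)
  have h₇ : f = a + 2 * b := of_mul ht (by push_cast; linarith)
  have h₈ : f' = 3 * a' + 2 * b' := of_mul hA (by push_cast; linarith)
  have h₀ : a = 0 ∧ b = 0 := by
    simp only [List.mem_cons, Prod.mk.injEq, List.not_mem_nil, or_false] at hS₁ hS₂ hS₃ hS₄ hS₅ hS₆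
    clear ha ha' hb hb' hc hc' hd hd' he he' hf hf'
    omega
  rw [h₀.1] at ha
  rw [h₀.2] at hb
  constructor <;> simp_all

theorem mem_roots_iff_exists_g2Comb
    (hirr : ∀ Φ₁ Φ₂ : Set E, Φ₁ ∪ Φ₂ = R.roots → Disjoint Φ₁ Φ₂ →
      (∀ a ∈ Φ₁, ∀ b ∈ Φ₂, ⟪a, b⟫ = 0) → Φ₁ = ∅ ∨ Φ₂ = ∅) (v : E) :
    v ∈ R.roots ↔ ∃ c ∈ g2Coeffs, g2Comb p q c = v := by
  have hmem := R.g2Comb_mem_roots hp hq hpp hpq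
  refine ⟨fun hv => ?_, by rintro ⟨c, hc, rfl⟩; exact hmem c hc⟩
  let Φ₁ : Set E := {v | ∃ c ∈ g2Coeffs, g2Comb p q c = v}
  have hsub : Φ₁ ⊆ R.roots := by rintro _ ⟨c, hc, rfl⟩; exact hmem c hc
  rcases hirr Φ₁ (R.roots \ Φ₁) (Set.union_sdiff_cancel hsub) Set.disjoint_sdiff_right (by
      rintro _ ⟨c, -, rfl⟩ w ⟨hw, hw'⟩
      obtain ⟨h₁, h₂⟩ := R.inner_eq_zero_of_ne_g2Comb hp hq hpp hpq hw
        fun c hc h => hw' ⟨c, hc, h⟩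
      rw [real_inner_comm, inner_g2Comb_right, h₁, h₂]
      simp) with h | h
  · exact absurd (show g2Comb p q (1, 0) ∈ Φ₁ from ⟨_, by decide, rfl⟩) (by simp [h])
  · exact Set.sdiff_eq_empty.1 h hv

end LongShort

end RootSystemWithBase

end G2

/-- If `Φ` is irreducible and of type `G₂` (i.e. there are roots `a, b` with
`⟨a,b∨⟩⟨b,a∨⟩ = 3`), then no combinatorial abelian ideal of `Φ⁺` contains two distinct
orthogonal roots. -/
theorem stmt_15 (R : RootSystemWithBase V)
    (hG2 : ∃ a ∈ R.roots, ∃ b ∈ R.roots, cartan a b * cartan b a = 3)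
    (hirr : ∀ Φ₁ Φ₂ : Set V, Φ₁ ∪ Φ₂ = R.roots → Disjoint Φ₁ Φ₂ →
      (∀ a ∈ Φ₁, ∀ b ∈ Φ₂, ⟪a, b⟫ = 0) → Φ₁ = ∅ ∨ Φ₂ = ∅)
    (I : Set V) (hI : R.IsAbelianIdeal I) :
    ∀ a ∈ I, ∀ b ∈ I, a ≠ b → cartan a b ≠ 0 := by
  intro a ha b hb _ hab
  obtain ⟨p, hp, q, hq, hpp, hpq⟩ := R.exists_long_short hG2
  have mem_iff := R.mem_roots_iff_exists_g2Comb hp hq hpp hpq hirr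
  have hab' : ⟪a, b⟫ = 0 := by
    have hb0 : ⟪b, b⟫ ≠ 0 := inner_self_ne_zero.mpr (R.ne_zero b (hI.1 hb).1)
    rw [cartan, div_eq_zero_iff] at hab
    linarith [hab.resolve_right hb0]
  obtain ⟨c, hc, hca⟩ := (mem_iff a).1 (hI.1 ha).1
  obtain ⟨c', hc', hcb⟩ := (mem_iff b).1 (hI.1 hb).1
  have hq0 : ⟪q, q⟫ ≠ 0 := inner_self_ne_zero.mpr (R.ne_zero q hq)
  have horth : g2Form c c' = 0 := by
    have h := two_mul_inner_g2Comb hpp hpq c c'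
    rw [hca, hcb, hab', mul_zero] at h
    exact_mod_cast (mul_eq_zero.1 h.symm).resolve_right hq0
  obtain ⟨d, hd, hd2, hdc, hdl⟩ := g2Coeffs_orthogonal c hc c' hc' horth
  have hx := (mem_iff _).2 ⟨d, hd, rfl⟩
  have hy := (mem_iff _).2 ⟨d - c, hdc, rfl⟩
  have hmid : g2Comb p q d + g2Comb p q d = a + b := by
    rw [← hca, ← hcb, ← g2Comb_add, ← g2Comb_add, hd2]
  rw [g2Comb_sub, hca] at hy
  have hxI : g2Comb p q d ∈ I := by
    rcases R.decomp _ hy with h | h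
    · refine hI.2.1 a ha _ ⟨hx, ?_⟩ h
      simpa using RootSystemWithBase.IsNN.add (hI.1 ha).2 h
    · have h' : R.IsNN (g2Comb p q d - b) := by
        have e : g2Comb p q d - b = -(g2Comb p q d - a) := by
          rw [← sub_eq_zero, ← sub_eq_zero.2 hmid]; abel
        rw [e]; exact h
      refine hI.2.1 b hb _ ⟨hx, ?_⟩ h'
      simpa using RootSystemWithBase.IsNN.add (hI.1 hb).2 h'
  rcases hdl with h | h
  · apply hI.2.2 _ hxI a ha
    rw [← hca, ← g2Comb_add]
    exact (mem_iff _).2 ⟨_, h, rfl⟩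
  · apply hI.2.2 _ hxI b hb
    rw [← hcb, ← g2Comb_add]
    exact (mem_iff _).2 ⟨_, h, rfl⟩
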